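/- The restriction of the Haar measure μ to X⁻¹O ∩ ᶜK is invariant under the Artin map: Ψ_*(μ|_{X⁻¹O ∩ ᶜK}) = μ|_{X⁻¹O ∩ ᶜK}. Equivalently, q·μ|_{X⁻¹O ∩ ᶜK} is a Ψ-invariant probability measure. -/

import Mathlib

open MeasureTheory
open scoped ENNReal Classical

noncomputable section

namespace ArtinCoding

variable (k : Type*) [Field k] [Fintype k]

/-- The field `K̂ = k((X⁻¹))` of formal Laurent series in `X⁻¹` over `k`, realized as the
field of formal Laurent series `k((t))` in the variable `t = X⁻¹`. -/
abbrev Khat := LaurentSeries k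

variable {k}

/-- The absolute value `|f|_∞ = q^{-v_∞(f)}`, where `v_∞` is the order of vanishing in the
variable `t = X⁻¹` (so a nonzero polynomial in `X` has absolute value `≥ 1`). -/
def absInf (f : Khat k) : ℝ :=
  if f = 0 then 0 else (Fintype.card k : ℝ) ^ (-f.order)

lemma absInf_nonneg (f : Khat k) : 0 ≤ absInf f := by
  unfold absInf
  split
  · exact le_refl 0
  · positivity

lemma absInf_eq_zero {f : Khat k} : absInf f = 0 ↔ f = 0 := by
  constructor
  · intro h
    by_contra hf
    have hq : (0:ℝ) < (Fintype.card k : ℝ) := by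
      have := Fintype.card_pos (α := k); positivity
    rw [absInf, if_neg hf] at h
    exact absurd h (ne_of_gt (zpow_pos hq _))
  · intro h; simp [absInf, h]

lemma absInf_neg (f : Khat k) : absInf (-f) = absInf f := by
  unfold absInf
  rw [neg_eq_zero, HahnSeries.order_neg]

lemma absInf_add_le (f g : Khat k) : absInf (f + g) ≤ max (absInf f) (absInf g) := by
  rcases eq_or_ne (f + g) 0 with h | h
  · rw [show absInf (f+g) = 0 by rw [absInf_eq_zero]; exact h]
    exact le_max_of_le_left (absInf_nonneg f)
  rcases eq_or_ne f 0 with hf | hf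
  · simp [hf]
  rcases eq_or_ne g 0 with hg | hg
  · simp [hg]
  have hmin := HahnSeries.min_order_le_order_add h
  have hq : (1:ℝ) ≤ (Fintype.card k : ℝ) := by
    exact_mod_cast Nat.one_le_iff_ne_zero.mpr Fintype.card_ne_zero
  rw [absInf, if_neg h]
  rcases le_total f.order g.order with hod | hod
  · rw [min_eq_left hod] at hmin
    refine le_max_of_le_left ?_
    rw [absInf, if_neg hf]
    exact zpow_le_zpow_right₀ hq (neg_le_neg hmin)
  · rw [min_eq_right hod] at hmin
    refine le_max_of_le_right ?_
    rw [absInf, if_neg hg]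
    exact zpow_le_zpow_right₀ hq (neg_le_neg hmin)

/-- The metric `d_∞(f,g) = |f-g|_∞` on `K̂`. -/
noncomputable instance : MetricSpace (Khat k) where
  dist f g := absInf (f - g)
  dist_self f := by simp [absInf]
  dist_comm f g := by
    have : g - f = -(f - g) := by ring
    show absInf (f - g) = absInf (g - f)
    rw [this, absInf_neg]
  dist_triangle f g h := by
    show absInf (f - h) ≤ absInf (f - g) + absInf (g - h)
    have key : absInf (f - h) ≤ max (absInf (f - g)) (absInf (g - h)) := by
      have : f - h = (f - g) + (g - h) := by ring
      rw [this]; exact absInf_add_le _ _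
    exact key.trans (max_le_add_of_nonneg (absInf_nonneg _) (absInf_nonneg _))
  eq_of_dist_eq_zero := by
    intro f g h
    have : f - g = 0 := absInf_eq_zero.mp h
    exact sub_eq_zero.mp this

/- Make sure the topology coming from the metric `d_∞` is the one used everywhere
(the valued-field uniformity on Laurent series induces the same topology). -/
instance (priority := 10000) : UniformSpace (Khat k) := PseudoMetricSpace.toUniformSpace
instance (priority := 10000) : TopologicalSpace (Khat k) := UniformSpace.toTopologicalSpace

instance : MeasurableSpace (Khat k) := borel _
instance : BorelSpace (Khat k) := ⟨rfl⟩

variable (k)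

/-- The element `X⁻¹` of `K̂` (the uniformizer `t`). -/
def Xinv : Khat k := HahnSeries.single (1 : ℤ) (1 : k)

/-- The element `X` of `K̂`. -/
def Xel : Khat k := HahnSeries.single (-1 : ℤ) (1 : k)

/-- The valuation ring `O = k[[X⁻¹]] = {f : |f|_∞ ≤ 1}`. -/
def Oball : Set (Khat k) := {f | absInf f ≤ 1}

/-- The set `X⁻¹O`, i.e. the maximal ideal of `O`. -/
def XinvO : Set (Khat k) := (fun f => Xinv k * f) '' Oball k

/-- The ring `A = k[X]` of polynomials in `X`, viewed as a subset of `K̂`. -/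
def Aset : Set (Khat k) := Set.range fun p : Polynomial k => Polynomial.aeval (Xel k) p

/-- The constants `k ⊆ K̂`. -/
def kconsts : Set (Khat k) := Set.range (algebraMap k (Khat k))

/-- The set `A∖k` of nonconstant polynomials in `X`, viewed inside `K̂`. -/
def AmK : Set (Khat k) := Aset k \ kconsts k

/-- The field `K = k(X)` of rational functions, viewed as a subset of `K̂`
(note that `k(X) = k(X⁻¹)` as a subfield of `K̂`). -/
def Kset : Set (Khat k) := Set.range fun r : RatFunc k => (r : LaurentSeries k)

/-- The set `ᶜK = K̂ ∖ K` of irrational elements. -/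
def cK : Set (Khat k) := (Kset k)ᶜ

variable {k}

/-- The integer part `[f] ∈ A = k[X]` of `f ∈ K̂`: the sum of the terms of `f` with
nonpositive exponents in `t = X⁻¹`. -/
def intPart (f : Khat k) : Khat k :=
  ∑ i ∈ Finset.Icc (min f.order 0) 0, HahnSeries.single i (f.coeff i)

/-- The fractional part `{f} = f - [f] ∈ X⁻¹O` of `f ∈ K̂`. -/
def fracPart (f : Khat k) : Khat k := f - intPart f

/-- The Artin map `Ψ(f) = 1/f - [1/f]`. -/
def ArtinPsi (f : Khat k) : Khat k := fracPart f⁻¹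

/-- The Artin continued fraction digit `a_{n+1}(f) = [1/Ψⁿ(f)]` (for `n : ℕ`, so that
`digit 0 f = a₁(f) = [1/f]`). -/
def digit (n : ℕ) (f : Khat k) : Khat k := intPart ((ArtinPsi (k := k))^[n] f)⁻¹

variable (k)

/-- The set `J = ⋃_{a ∈ A∖k} (a + X⁻¹O)`. -/
def Jset : Set (Khat k) := ⋃ a ∈ AmK k, (fun x => a + x) '' XinvO k

/-- The domain `Ω = (J ∩ ᶜK) × (X⁻¹O ∩ ᶜK)` of the natural extension of the Artin map. -/
def OmegaSet : Set (Khat k × Khat k) := (Jset k ∩ cK k) ×ˢ (XinvO k ∩ cK k)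

variable {k}

/-- The map `Φ(ξ₋, ξ₊) = (1/ξ₋ - [1/ξ₊], Ψ(ξ₊))` (as a globally defined map on `K̂ × K̂`). -/
def PhiRaw (p : Khat k × Khat k) : Khat k × Khat k :=
  (p.1⁻¹ - intPart p.2⁻¹, ArtinPsi p.2)

/-- The coding map `Θ'` sending `(ξ₋, ξ₊)` to the bilateral sequence `(c_n)_{n ∈ ℤ}` with
`c_n = a_n(ξ₊)` for `n ≥ 1` and `c_{-n} = a_{n+1}(-1/ξ₋)` for `n ≥ 0`. -/
def ThetaRaw (p : Khat k × Khat k) : ℤ → Khat k := fun n =>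
  if 1 ≤ n then digit (n - 1).toNat p.2 else digit (-n).toNat (-p.1⁻¹)

variable (k)

/-- The density `q²/|ξ₊ - ξ₋|²_∞`. -/
def dens (p : Khat k × Khat k) : ℝ≥0∞ :=
  ENNReal.ofReal ((Fintype.card k : ℝ) ^ 2 * ((absInf (p.2 - p.1)) ^ 2)⁻¹)

/-- The measure `m̂` on `Ω` given by `dm̂(ξ₋,ξ₊) = q² dμ(ξ₋) dμ(ξ₊)/|ξ₊ - ξ₋|²_∞`. -/
def mhat (μ : Measure (Khat k)) : Measure (Khat k × Khat k) :=
  (((μ.prod μ).withDensity (dens k))).restrict (OmegaSet k)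

/-- The weight `ν(a) = |a|_∞⁻² = q^{-2 deg a}` for `a ∈ A∖k` (and `0` otherwise),
with values in `ℝ≥0∞`. -/
def nuE (a : Khat k) : ℝ≥0∞ :=
  if a ∈ AmK k then ENNReal.ofReal (((absInf a) ^ 2)⁻¹) else 0

section

open Metric

variable {k}

lemma one_lt_card : (1 : ℝ) < Fintype.card k := by
  exact_mod_cast Fintype.one_lt_card

lemma card_pos : (0 : ℝ) < Fintype.card k := zero_lt_one.trans one_lt_card

lemma dist_eq_absInf (f g : Khat k) : dist f g = absInf (f - g) := rfl

lemma mem_ball_iff_absInf {f a : Khat k} {r : ℝ} : f ∈ ball a r ↔ absInf (f - a) < r := Iff.rfl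

lemma absInf_zero : absInf (0 : Khat k) = 0 := absInf_eq_zero.mpr rfl

lemma absInf_one : absInf (1 : Khat k) = 1 := by
  simp [absInf]

lemma absInf_mul (f g : Khat k) : absInf (f * g) = absInf f * absInf g := by
  by_cases hf : f = 0
  · simp [hf, absInf_zero]
  by_cases hg : g = 0
  · simp [hg, absInf_zero]
  rw [absInf, absInf, absInf, if_neg hf, if_neg hg, if_neg (mul_ne_zero hf hg),
    HahnSeries.order_mul hf hg, neg_add, zpow_add₀ card_pos.ne']

lemma absInf_inv (f : Khat k) : absInf f⁻¹ = (absInf f)⁻¹ := by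
  by_cases hf : f = 0
  · simp [hf, absInf_zero]
  refine eq_inv_of_mul_eq_one_left ?_
  rw [← absInf_mul, inv_mul_cancel₀ hf, absInf_one]

lemma absInf_lt_zpow_iff {f : Khat k} {n : ℤ} :
    absInf f < (Fintype.card k : ℝ) ^ (-n) ↔ ∀ i ≤ n, f.coeff i = 0 := by
  by_cases hf : f = 0
  · simp [hf, absInf_zero, zpow_pos (card_pos (k := k))]
  rw [absInf, if_neg hf, zpow_lt_zpow_iff_right₀ one_lt_card, neg_lt_neg_iff]
  constructor
  · intro h i hi
    exact HahnSeries.coeff_eq_zero_of_lt_order (hi.trans_lt h)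
  · intro h
    by_contra! hle
    exact HahnSeries.coeff_order_eq_zero.not.mpr hf (h _ hle)

lemma absInf_lt_one_iff {f : Khat k} : absInf f < 1 ↔ ∀ i ≤ 0, f.coeff i = 0 := by
  simpa using absInf_lt_zpow_iff (f := f) (n := 0)

lemma absInf_Xinv : absInf (Xinv k) = (Fintype.card k : ℝ)⁻¹ := by
  rw [absInf, Xinv, if_neg (HahnSeries.single_ne_zero one_ne_zero),
    HahnSeries.order_single one_ne_zero, zpow_neg_one]

lemma absInf_le_one_iff {f : Khat k} : absInf f ≤ 1 ↔ absInf f < Fintype.card k := by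
  refine ⟨fun h => h.trans_lt one_lt_card, fun h => ?_⟩
  by_cases hf : f = 0
  · simp [hf, absInf_zero]
  rw [absInf, if_neg hf] at h ⊢
  rw [← zpow_one (Fintype.card k : ℝ), ← zpow_mul, one_mul,
    zpow_lt_zpow_iff_right₀ one_lt_card] at h
  exact zpow_le_one_of_nonpos₀ one_lt_card.le (by omega)

lemma Oball_eq_ball : Oball k = ball 0 ((Fintype.card k : ℝ) ^ (-(-1) : ℤ)) := by
  ext f
  rw [mem_ball_iff_absInf, sub_zero, neg_neg, zpow_one]
  exact absInf_le_one_iff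

lemma XinvO_eq_ball : XinvO k = ball 0 1 := by
  have hX : Xinv k ≠ 0 := HahnSeries.single_ne_zero one_ne_zero
  ext f
  rw [mem_ball_iff_absInf, sub_zero, XinvO]
  constructor
  · rintro ⟨g, hg, rfl⟩
    rw [absInf_mul, absInf_Xinv, inv_mul_lt_iff₀ card_pos, mul_one]
    exact absInf_le_one_iff.mp hg
  · intro hf
    refine ⟨(Xinv k)⁻¹ * f, ?_, mul_inv_cancel_left₀ hX f⟩
    rw [Oball, Set.mem_ofPred_eq, absInf_le_one_iff, absInf_mul, absInf_inv, absInf_Xinv, inv_inv]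
    exact mul_lt_of_lt_one_right card_pos hf

instance : IsUltrametricDist (Khat k) where
  dist_triangle_max f g h := by
    simp only [dist_eq_absInf]
    simpa using absInf_add_le (f - g) (g - h)

lemma exists_zpow_lt {ε : ℝ} (hε : 0 < ε) : ∃ n : ℕ, (Fintype.card k : ℝ) ^ (-n : ℤ) < ε := by
  obtain ⟨n, hn⟩ := exists_pow_lt_of_lt_one hε (inv_lt_one_of_one_lt₀ (one_lt_card (k := k)))
  exact ⟨n, by simpa using hn⟩

lemma denseRange_ofFinsupp :
    DenseRange (HahnSeries.ofFinsupp : (ℤ →₀ k) → Khat k) := by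
  intro f
  rw [Metric.mem_closure_range_iff]
  intro ε hε
  obtain ⟨n, hn⟩ := exists_zpow_lt (k := k) hε
  refine ⟨Finsupp.onFinset (Finset.Icc f.order n) (fun i => if i ≤ n then f.coeff i else 0) ?_, ?_⟩
  · intro i hi
    simp only [ne_eq, ite_eq_right_iff, not_forall] at hi
    obtain ⟨hin, hi⟩ := hi
    exact Finset.mem_Icc.mpr ⟨HahnSeries.order_le_of_coeff_ne_zero hi, hin⟩
  · refine lt_trans ?_ hn
    rw [dist_eq_absInf, absInf_lt_zpow_iff]
    intro i hi
    simp [hi]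

instance : SecondCountableTopology (Khat k) :=
  haveI : TopologicalSpace.SeparableSpace (Khat k) :=
    ⟨⟨_, Set.countable_range _, denseRange_ofFinsupp⟩⟩
  UniformSpace.secondCountable_of_separable (Khat k)

/-- The balls of radius `q ^ (-n)`, `n : ℕ`. -/
def smallBalls (k : Type*) [Field k] [Fintype k] : Set (Set (Khat k)) :=
  {s | ∃ (a : Khat k) (n : ℕ), s = ball a ((Fintype.card k : ℝ) ^ (-n : ℤ))}

lemma isPiSystem_smallBalls : IsPiSystem (smallBalls k) := by
  rintro _ ⟨a, n, rfl⟩ _ ⟨b, m, rfl⟩ ⟨c, hca, hcb⟩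
  rw [IsUltrametricDist.ball_eq_of_mem hca, IsUltrametricDist.ball_eq_of_mem hcb]
  rcases le_total ((Fintype.card k : ℝ) ^ (-n : ℤ)) ((Fintype.card k : ℝ) ^ (-m : ℤ)) with h | h
  · rw [Set.inter_eq_left.mpr (ball_subset_ball h)]
    exact ⟨c, n, rfl⟩
  · rw [Set.inter_eq_right.mpr (ball_subset_ball h)]
    exact ⟨c, m, rfl⟩

lemma isTopologicalBasis_smallBalls : TopologicalSpace.IsTopologicalBasis (smallBalls k) := by
  refine TopologicalSpace.isTopologicalBasis_of_isOpen_of_nhds ?_ ?_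
  · rintro _ ⟨a, n, rfl⟩
    exact isOpen_ball
  · intro a u ha hu
    obtain ⟨ε, hε, hsub⟩ := Metric.isOpen_iff.mp hu a ha
    obtain ⟨n, hn⟩ := exists_zpow_lt (k := k) hε
    exact ⟨_, ⟨a, n, rfl⟩, mem_ball_self (zpow_pos card_pos _), (ball_subset_ball hn.le).trans hsub⟩

lemma measurableSpace_eq_generateFrom_smallBalls :
    (inferInstance : MeasurableSpace (Khat k)) = MeasurableSpace.generateFrom (smallBalls k) :=
  isTopologicalBasis_smallBalls.borel_eq_generateFrom

lemma ball_eq_iUnion_ball_single (n : ℤ) :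
    ball (0 : Khat k) ((Fintype.card k : ℝ) ^ (-n)) =
      ⋃ c : k, ball (HahnSeries.single (n + 1) c) ((Fintype.card k : ℝ) ^ (-(n + 1))) := by
  ext f
  simp only [Set.mem_iUnion, mem_ball_iff_absInf, absInf_lt_zpow_iff, sub_zero,
    HahnSeries.coeff_sub, HahnSeries.coeff_single]
  constructor
  · intro h
    refine ⟨f.coeff (n + 1), fun i hi => ?_⟩
    split_ifs with hin
    · simp [hin]
    · simp [h i (by omega)]
  · rintro ⟨c, hc⟩ i hi
    simpa [show i ≠ n + 1 by omega] using hc i (by omega)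

lemma disjoint_ball_single (n : ℤ) :
    Pairwise (Function.onFun Disjoint fun c : k =>
      ball (HahnSeries.single (n + 1) c : Khat k) ((Fintype.card k : ℝ) ^ (-(n + 1)))) := by
  intro c d hcd
  rw [Function.onFun, Set.disjoint_left]
  intro f hc hd
  rw [mem_ball_iff_absInf, absInf_lt_zpow_iff] at hc hd
  have h1 := hc (n + 1) le_rfl
  have h2 := hd (n + 1) le_rfl
  simp only [HahnSeries.coeff_sub, HahnSeries.coeff_single_same, sub_eq_zero] at h1 h2
  exact hcd (h1.symm.trans h2)

lemma measure_ball_eq_card_mul (ν : Measure (Khat k)) (n : ℤ)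
    (h : ∀ a ∈ ball (0 : Khat k) ((Fintype.card k : ℝ) ^ (-n)),
      ν (ball a ((Fintype.card k : ℝ) ^ (-(n + 1)))) =
        ν (ball 0 ((Fintype.card k : ℝ) ^ (-(n + 1))))) :
    ν (ball 0 ((Fintype.card k : ℝ) ^ (-n))) =
      Fintype.card k * ν (ball 0 ((Fintype.card k : ℝ) ^ (-(n + 1)))) := by
  rw [ball_eq_iUnion_ball_single, measure_iUnion (disjoint_ball_single n)
    fun _ => isOpen_ball.measurableSet, tsum_fintype]
  rw [Finset.sum_congr rfl fun c _ => h _ ?_]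
  · simp
  · rw [mem_ball_iff_absInf, absInf_lt_zpow_iff]
    intro i hi
    simp [show i ≠ n + 1 by omega]

/-- A finite measure on the unit ball giving the same mass to all balls of equal small radius
is determined by its total mass. -/
lemma measure_ext_of_ball_eq (ν₁ ν₂ : Measure (Khat k)) [IsFiniteMeasure ν₁]
    (hc₁ : ν₁ (ball 0 1)ᶜ = 0) (hc₂ : ν₂ (ball 0 1)ᶜ = 0)
    (hE : ν₁ (ball 0 1) = ν₂ (ball 0 1))
    (h₁ : ∀ n : ℕ, ∀ a ∈ ball (0 : Khat k) 1,
      ν₁ (ball a ((Fintype.card k : ℝ) ^ (-n : ℤ))) = ν₁ (ball 0 ((Fintype.card k : ℝ) ^ (-n : ℤ))))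
    (h₂ : ∀ n : ℕ, ∀ a ∈ ball (0 : Khat k) 1,
      ν₂ (ball a ((Fintype.card k : ℝ) ^ (-n : ℤ))) =
        ν₂ (ball 0 ((Fintype.card k : ℝ) ^ (-n : ℤ)))) :
    ν₁ = ν₂ := by
  have hrad : ∀ n : ℕ, (Fintype.card k : ℝ) ^ (-n : ℤ) ≤ 1 := fun n =>
    zpow_le_one_of_nonpos₀ one_lt_card.le (by omega)
  have hzero : ∀ n : ℕ, ν₁ (ball 0 ((Fintype.card k : ℝ) ^ (-n : ℤ))) =
      ν₂ (ball 0 ((Fintype.card k : ℝ) ^ (-n : ℤ))) := by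
    intro n
    induction n with
    | zero => simpa using hE
    | succ n ih =>
      have e₁ := measure_ball_eq_card_mul ν₁ n fun a ha => by
        exact_mod_cast h₁ (n + 1) a (ball_subset_ball (hrad n) ha)
      have e₂ := measure_ball_eq_card_mul ν₂ n fun a ha => by
        exact_mod_cast h₂ (n + 1) a (ball_subset_ball (hrad n) ha)
      rw [ih, e₂, ENNReal.mul_right_inj (by simp) (by simp)] at e₁
      exact_mod_cast e₁.symm
  refine ext_of_generate_finite (smallBalls k) measurableSpace_eq_generateFrom_smallBalls
    isPiSystem_smallBalls ?_ ?_
  · rintro _ ⟨a, n, rfl⟩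
    by_cases ha : a ∈ ball (0 : Khat k) 1
    · rw [h₁ n a ha, h₂ n a ha, hzero n]
    · have hsub : ball a ((Fintype.card k : ℝ) ^ (-n : ℤ)) ⊆ (ball 0 1)ᶜ := by
        intro f hf hf0
        refine ha ?_
        rw [IsUltrametricDist.ball_eq_of_mem hf0, mem_ball, dist_comm]
        exact (mem_ball.mp hf).trans_le (hrad n)
      rw [measure_mono_null hsub hc₁, measure_mono_null hsub hc₂]
  · have hm : MeasurableSet (ball (0 : Khat k) 1) := isOpen_ball.measurableSet
    rw [← measure_add_measure_compl (μ := ν₁) hm, ← measure_add_measure_compl (μ := ν₂) hm,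
      hE, hc₁, hc₂]

lemma coeff_fracPart {k : Type*} [Field k] (f : Khat k) (i : ℤ) :
    (fracPart f).coeff i = if i ≤ 0 then 0 else f.coeff i := by
  rw [fracPart, intPart, HahnSeries.coeff_sub, HahnSeries.coeff_sum]
  have hsum : ∑ j ∈ Finset.Icc (min f.order 0) 0, (HahnSeries.single j (f.coeff j)).coeff i =
      if i ∈ Finset.Icc (min f.order 0) 0 then f.coeff i else 0 := by
    rw [← Finset.sum_ite_eq]
    refine Finset.sum_congr rfl fun j _ => ?_
    split_ifs with h
    · rw [h, HahnSeries.coeff_single_same]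
    · exact HahnSeries.coeff_single_of_ne h
  rw [hsum]
  split_ifs with h1 h2 h2
  · simp
  · rw [Finset.mem_Icc] at h1
    omega
  · rw [Finset.mem_Icc] at h1
    rw [HahnSeries.coeff_eq_zero_of_lt_order (by omega), sub_zero]
  · simp

lemma fracPart_sub {k : Type*} [Field k] (f g : Khat k) : fracPart f - fracPart g = fracPart (f - g) := by
  ext i
  simp only [HahnSeries.coeff_sub, coeff_fracPart]
  split_ifs <;> simp

lemma fracPart_of_absInf_lt_one {f : Khat k} (hf : absInf f < 1) : fracPart f = f := by
  rw [absInf_lt_one_iff] at hf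
  ext i
  rw [coeff_fracPart]
  split_ifs with h
  · rw [hf i h]
  · rfl

lemma absInf_fracPart_lt_one (f : Khat k) : absInf (fracPart f) < 1 := by
  rw [absInf_lt_one_iff]
  intro i hi
  simp [coeff_fracPart, hi]

lemma continuous_fracPart : Continuous (fracPart (k := k)) := by
  rw [Metric.continuous_iff]
  intro f ε hε
  refine ⟨min 1 ε, by positivity, fun g hg => ?_⟩
  rw [dist_eq_absInf] at hg ⊢
  rw [fracPart_sub, fracPart_of_absInf_lt_one (hg.trans_le (min_le_left _ _))]
  exact hg.trans_le (min_le_right _ _)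

lemma absInf_eq_of_absInf_sub_lt {f g : Khat k} (h : absInf (f - g) < absInf g) :
    absInf f = absInf g := by
  have h1 := absInf_add_le (f - g) g
  have h2 := absInf_add_le (-(f - g)) f
  rw [absInf_neg] at h2
  rw [sub_add_cancel, max_eq_right h.le] at h1
  rw [neg_sub, sub_add_cancel] at h2
  rcases le_max_iff.mp h2 with h3 | h3
  · exact absurd h3 h.not_ge
  · exact le_antisymm h1 h3

lemma continuousOn_inv_compl_zero : ContinuousOn (fun f : Khat k => f⁻¹) {0}ᶜ := by
  rw [Metric.continuousOn_iff]
  intro f hf ε hε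
  have hf0 : f ≠ 0 := hf
  have hpos : 0 < absInf f := (absInf_nonneg f).lt_of_ne' (absInf_eq_zero.not.mpr hf0)
  refine ⟨min (absInf f) (ε * absInf f ^ 2), by positivity, fun g hg hgf => ?_⟩
  have hg0 : g ≠ 0 := hg
  rw [dist_eq_absInf] at hgf ⊢
  have habs := absInf_eq_of_absInf_sub_lt (hgf.trans_le (min_le_left _ _))
  have hinv : g⁻¹ - f⁻¹ = -(g - f) * (g⁻¹ * f⁻¹) := by
    field_simp
    ring
  rw [hinv, absInf_mul, absInf_mul, absInf_neg, absInf_inv, absInf_inv, habs, ← mul_inv, ← sq,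
    ← div_eq_mul_inv, div_lt_iff₀ (by positivity)]
  exact hgf.trans_le (min_le_right _ _)

lemma measurable_ArtinPsi : Measurable (ArtinPsi (k := k)) := by
  refine continuous_fracPart.measurable.comp ?_
  exact measurable_of_continuousOn_compl_singleton 0 continuousOn_inv_compl_zero

/-- The transformation `f ↦ f / (1 + b f)`, i.e. `1/f ↦ 1/f + b` read on `f`. -/
def invTranslate (b f : Khat k) : Khat k := f * (1 + b * f)⁻¹

lemma absInf_one_add_mul {b f : Khat k} (hb : absInf b < 1) (hf : absInf f < 1) :
    absInf (1 + b * f) = 1 := by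
  rw [← absInf_one (k := k)]
  refine absInf_eq_of_absInf_sub_lt ?_
  rw [add_sub_cancel_left, absInf_mul, absInf_one]
  exact mul_lt_one_of_nonneg_of_lt_one_left (absInf_nonneg b) hb hf.le

lemma one_add_mul_ne_zero {b f : Khat k} (hb : absInf b < 1) (hf : absInf f < 1) :
    1 + b * f ≠ 0 := by
  intro h
  have := absInf_one_add_mul hb hf
  rw [h, absInf_zero] at this
  exact zero_ne_one this

lemma absInf_invTranslate {b f : Khat k} (hb : absInf b < 1) (hf : absInf f < 1) :
    absInf (invTranslate b f) = absInf f := by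
  rw [invTranslate, absInf_mul, absInf_inv, absInf_one_add_mul hb hf, inv_one, mul_one]

lemma absInf_invTranslate_sub {b f g : Khat k} (hb : absInf b < 1) (hf : absInf f < 1)
    (hg : absInf g < 1) : absInf (invTranslate b f - invTranslate b g) = absInf (f - g) := by
  have h : invTranslate b f - invTranslate b g =
      (f - g) * ((1 + b * f)⁻¹ * (1 + b * g)⁻¹) := by
    have h1 := one_add_mul_ne_zero hb hf
    have h2 := one_add_mul_ne_zero hb hg
    rw [invTranslate, invTranslate, ← div_eq_mul_inv, ← div_eq_mul_inv, div_sub_div _ _ h1 h2,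
      ← mul_inv, ← div_eq_mul_inv]
    ring
  rw [h, absInf_mul, absInf_mul, absInf_inv, absInf_inv, absInf_one_add_mul hb hf,
    absInf_one_add_mul hb hg, inv_one, mul_one, mul_one]

lemma invTranslate_invTranslate_neg {b f : Khat k} (hb : absInf b < 1) (hf : absInf f < 1) :
    invTranslate b (invTranslate (-b) f) = f := by
  have h := one_add_mul_ne_zero (b := -b) (by rwa [absInf_neg]) hf
  have h' : 1 + b * (f * (1 + -b * f)⁻¹) = (1 + -b * f)⁻¹ := by
    refine mul_right_cancel₀ h ?_
    rw [inv_mul_cancel₀ h, add_mul, ← mul_assoc, inv_mul_cancel_right₀ h]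
    ring
  rw [invTranslate, invTranslate, h', inv_inv, mul_assoc, inv_mul_cancel₀ h, mul_one]

lemma continuousOn_invTranslate {b : Khat k} (hb : absInf b < 1) :
    ContinuousOn (invTranslate b) (ball 0 1) := by
  rw [Metric.continuousOn_iff]
  intro f hf ε hε
  refine ⟨ε, hε, fun g hg hgf => ?_⟩
  rw [mem_ball_iff_absInf, sub_zero] at hf hg
  rw [dist_eq_absInf] at hgf ⊢
  rwa [absInf_invTranslate_sub hb hg hf]

lemma inter_preimage_invTranslate_ball {b a : Khat k} {r : ℝ} (hb : absInf b < 1)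
    (ha : absInf a < 1) (hr : r ≤ 1) :
    invTranslate b ⁻¹' ball a r ∩ ball 0 1 = ball (invTranslate (-b) a) r := by
  have hnb : absInf (-b) < 1 := by rwa [absInf_neg]
  have hTa : absInf (invTranslate (-b) a) < 1 := by rwa [absInf_invTranslate hnb ha]
  have key : ∀ f : Khat k, absInf f < 1 →
      absInf (invTranslate b f - a) = absInf (f - invTranslate (-b) a) := by
    intro f hf
    conv_lhs => rw [← invTranslate_invTranslate_neg hb ha]
    exact absInf_invTranslate_sub hb hf hTa
  ext f
  simp only [Set.mem_inter_iff, Set.mem_preimage, mem_ball_iff_absInf, sub_zero]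
  constructor
  · rintro ⟨h1, h2⟩
    rwa [← key f h2]
  · intro h
    have hf : absInf f < 1 := by
      have := absInf_add_le (f - invTranslate (-b) a) (invTranslate (-b) a)
      rw [sub_add_cancel] at this
      exact this.trans_lt (max_lt (h.trans_le hr) hTa)
    exact ⟨by rwa [key f hf], hf⟩

lemma ArtinPsi_invTranslate {b f : Khat k} (hb : absInf b < 1) (hf : absInf f < 1) (hf0 : f ≠ 0) :
    ArtinPsi (invTranslate b f) = ArtinPsi f + b := by
  have h : (invTranslate b f)⁻¹ = f⁻¹ + b := by
    have h1 := one_add_mul_ne_zero hb hf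
    rw [invTranslate, mul_inv, inv_inv]
    field_simp
  rw [ArtinPsi, h, ArtinPsi, ← sub_eq_iff_eq_add', fracPart_sub, add_sub_cancel_left,
    fracPart_of_absInf_lt_one hb]

lemma countable_Kset : (Kset k).Countable := by
  have : Countable (Polynomial k) := Cardinal.mk_le_aleph0_iff.mp <|
    Polynomial.cardinalMk_le_max.trans (max_le Cardinal.mk_le_aleph0 le_rfl)
  have : Countable (RatFunc k) := by
    refine Function.Injective.countable (f := fun r : RatFunc k => (r.num, r.denom)) ?_
    intro r s h
    simp only [Prod.mk.injEq] at h
    rw [← RatFunc.num_div_denom r, ← RatFunc.num_div_denom s, h.1, h.2]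
  exact Set.countable_range _

lemma measurable_add_left (x : Khat k) : Measurable fun y : Khat k => x + y := by
  refine (Isometry.of_dist_eq fun y z => ?_).continuous.measurable
  rw [dist_eq_absInf, dist_eq_absInf, add_sub_add_left_eq_sub]

lemma measure_ball_eq {μ : Measure (Khat k)}
    (hinv : ∀ x : Khat k, Measure.map (fun y => x + y) μ = μ) (a : Khat k) (r : ℝ) : μ (ball a r) = μ (ball 0 r) := by
  conv_lhs => rw [← hinv a, Measure.map_apply (measurable_add_left a) isOpen_ball.measurableSet]
  congr 1
  ext f
  rw [Set.mem_preimage, mem_ball_iff_absInf, mem_ball_iff_absInf, add_sub_cancel_left, sub_zero]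

lemma measure_ball_zpow_eq_inv_mul {μ : Measure (Khat k)}
    (hinv : ∀ x : Khat k, Measure.map (fun y => x + y) μ = μ) (n : ℤ) :
    μ (ball 0 ((Fintype.card k : ℝ) ^ (-(n + 1)))) =
      (Fintype.card k : ℝ≥0∞)⁻¹ * μ (ball 0 ((Fintype.card k : ℝ) ^ (-n))) := by
  rw [measure_ball_eq_card_mul μ n fun a _ => measure_ball_eq hinv a _, ← mul_assoc,
    ENNReal.inv_mul_cancel (by simp) (by simp), one_mul]

lemma measure_unit_ball {μ : Measure (Khat k)}
    (hinv : ∀ x : Khat k, Measure.map (fun y => x + y) μ = μ) (hO : μ (Oball k) = 1) :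
    μ (ball 0 1) = (Fintype.card k : ℝ≥0∞)⁻¹ := by
  have h := measure_ball_zpow_eq_inv_mul hinv (-1)
  rw [← Oball_eq_ball, hO] at h
  simpa using h

lemma measure_singleton_eq_zero {μ : Measure (Khat k)}
    (hinv : ∀ x : Khat k, Measure.map (fun y => x + y) μ = μ) (hO : μ (Oball k) = 1)
    (x : Khat k) : μ {x} = 0 := by
  have hball : ∀ n : ℕ, μ (ball 0 ((Fintype.card k : ℝ) ^ (-n : ℤ))) =
      (Fintype.card k : ℝ≥0∞)⁻¹ ^ n * (Fintype.card k : ℝ≥0∞)⁻¹ := by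
    intro n
    induction n with
    | zero => simpa using measure_unit_ball hinv hO
    | succ n ih =>
      have h := measure_ball_zpow_eq_inv_mul hinv n
      rw [ih, ← mul_assoc, ← pow_succ'] at h
      exact_mod_cast h
  have hlt : (Fintype.card k : ℝ≥0∞)⁻¹ < 1 := by
    rw [ENNReal.inv_lt_one]
    exact_mod_cast Fintype.one_lt_card (α := k)
  have hlim := ENNReal.Tendsto.mul_const
    (ENNReal.tendsto_pow_atTop_nhds_zero_of_lt_one hlt)
    (Or.inr (ENNReal.inv_ne_top.mpr (by simp) : (Fintype.card k : ℝ≥0∞)⁻¹ ≠ ⊤))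
  rw [zero_mul] at hlim
  refine le_antisymm (ge_of_tendsto' hlim fun n => ?_) zero_le
  rw [← hball n, ← measure_ball_eq hinv x]
  exact measure_mono (Set.singleton_subset_iff.mpr (mem_ball_self (zpow_pos card_pos _)))

lemma restrict_inter_cK {μ : Measure (Khat k)}
    (hinv : ∀ x : Khat k, Measure.map (fun y => x + y) μ = μ) (hO : μ (Oball k) = 1) :
    μ.restrict (XinvO k ∩ cK k) = μ.restrict (ball 0 1) := by
  have : NullSingletonClass μ := ⟨measure_singleton_eq_zero hinv hO⟩
  rw [XinvO_eq_ball]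
  refine Measure.restrict_congr_set (inter_ae_eq_left_of_ae_eq_univ ?_)
  rw [ae_eq_univ, cK, compl_compl]
  exact countable_Kset.measure_zero μ

lemma isFiniteMeasure_restrict_unit_ball {μ : Measure (Khat k)}
    (hinv : ∀ x : Khat k, Measure.map (fun y => x + y) μ = μ) (hO : μ (Oball k) = 1) :
    IsFiniteMeasure (μ.restrict (ball 0 1)) := by
  refine ⟨?_⟩
  rw [Measure.restrict_apply_univ, measure_unit_ball hinv hO]
  exact ENNReal.inv_lt_top.mpr (by exact_mod_cast Fintype.card_pos (α := k))

lemma restrict_unit_ball_apply_ball {μ : Measure (Khat k)}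
    (hinv : ∀ x : Khat k, Measure.map (fun y => x + y) μ = μ) {a : Khat k}
    (ha : a ∈ ball 0 1) {r : ℝ} (hr : r ≤ 1) :
    μ.restrict (ball 0 1) (ball a r) = μ (ball 0 r) := by
  rw [Measure.restrict_apply isOpen_ball.measurableSet, Set.inter_eq_left.mpr,
    measure_ball_eq hinv]
  rw [IsUltrametricDist.ball_eq_of_mem ha]
  exact ball_subset_ball hr

/-- A map from the unit ball to itself preserves the Haar measure as soon as the preimages of balls
of equal small radius all have the same mass. -/
lemma map_restrict_unit_ball_eq {μ : Measure (Khat k)}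
    (hinv : ∀ x : Khat k, Measure.map (fun y => x + y) μ = μ) (hO : μ (Oball k) = 1)
    {T : Khat k → Khat k} (hT : AEMeasurable T (μ.restrict (ball 0 1)))
    (hmaps : Set.MapsTo T (ball 0 1) (ball 0 1))
    (h : ∀ n : ℕ, ∀ a ∈ ball (0 : Khat k) 1,
      μ.restrict (ball 0 1) (T ⁻¹' ball a ((Fintype.card k : ℝ) ^ (-n : ℤ))) =
        μ.restrict (ball 0 1) (T ⁻¹' ball 0 ((Fintype.card k : ℝ) ^ (-n : ℤ)))) :
    Measure.map T (μ.restrict (ball 0 1)) = μ.restrict (ball 0 1) := by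
  have hm : ∀ (a : Khat k) (r : ℝ), MeasurableSet (ball a r) := fun _ _ =>
    isOpen_ball.measurableSet
  have hrad : ∀ n : ℕ, (Fintype.card k : ℝ) ^ (-n : ℤ) ≤ 1 := fun n =>
    zpow_le_one_of_nonpos₀ one_lt_card.le (by omega)
  have := isFiniteMeasure_restrict_unit_ball hinv hO
  refine measure_ext_of_ball_eq _ _ ?_ ?_ ?_ ?_ ?_
  · rw [Measure.map_apply_of_aemeasurable hT (hm _ _).compl,
      Measure.restrict_apply' (hm _ _), Set.preimage_compl]
    convert measure_empty (μ := μ)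
    rw [← Set.sdiff_eq_compl_inter, Set.sdiff_eq_empty]
    exact hmaps
  · rw [Measure.restrict_apply (hm _ _).compl, Set.compl_inter_self, measure_empty]
  · rw [Measure.map_apply_of_aemeasurable hT (hm _ _), Measure.restrict_apply' (hm _ _),
      Set.inter_eq_right.mpr (show ball 0 1 ⊆ T ⁻¹' ball 0 1 from hmaps), Measure.restrict_apply_self]
  · intro n a ha
    rw [Measure.map_apply_of_aemeasurable hT (hm _ _),
      Measure.map_apply_of_aemeasurable hT (hm _ _), h n a ha]
  · intro n a ha
    rw [restrict_unit_ball_apply_ball hinv ha (hrad n),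
      restrict_unit_ball_apply_ball hinv (mem_ball_self one_pos) (hrad n)]

lemma aemeasurable_invTranslate (μ : Measure (Khat k)) {b : Khat k} (hb : absInf b < 1) :
    AEMeasurable (invTranslate b) (μ.restrict (ball 0 1)) :=
  (continuousOn_invTranslate hb).aemeasurable isOpen_ball.measurableSet

lemma map_invTranslate {μ : Measure (Khat k)}
    (hinv : ∀ x : Khat k, Measure.map (fun y => x + y) μ = μ) (hO : μ (Oball k) = 1)
    {b : Khat k} (hb : absInf b < 1) :
    Measure.map (invTranslate b) (μ.restrict (ball 0 1)) = μ.restrict (ball 0 1) := by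
  refine map_restrict_unit_ball_eq hinv hO (aemeasurable_invTranslate μ hb) ?_ ?_
  · intro f hf
    rw [mem_ball_iff_absInf, sub_zero] at hf ⊢
    rwa [absInf_invTranslate hb hf]
  · intro n a ha
    rw [mem_ball_iff_absInf, sub_zero] at ha
    have hrad : (Fintype.card k : ℝ) ^ (-n : ℤ) ≤ 1 :=
      zpow_le_one_of_nonpos₀ one_lt_card.le (by omega)
    rw [Measure.restrict_apply' isOpen_ball.measurableSet,
      Measure.restrict_apply' isOpen_ball.measurableSet,
      inter_preimage_invTranslate_ball hb ha hrad,
      inter_preimage_invTranslate_ball hb (absInf_zero.trans_lt one_pos) hrad,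
      measure_ball_eq hinv, measure_ball_eq hinv (invTranslate _ 0)]

lemma map_ArtinPsi_restrict_unit_ball {μ : Measure (Khat k)}
    (hinv : ∀ x : Khat k, Measure.map (fun y => x + y) μ = μ) (hO : μ (Oball k) = 1) :
    Measure.map ArtinPsi (μ.restrict (ball 0 1)) = μ.restrict (ball 0 1) := by
  refine map_restrict_unit_ball_eq hinv hO measurable_ArtinPsi.aemeasurable ?_ ?_
  · intro f _
    rw [mem_ball_iff_absInf, sub_zero]
    exact absInf_fracPart_lt_one _
  · intro n a ha
    rw [mem_ball_iff_absInf, sub_zero] at ha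
    conv_lhs => rw [← map_invTranslate hinv hO ha]
    rw [Measure.map_apply_of_aemeasurable (aemeasurable_invTranslate μ ha)
      (measurable_ArtinPsi isOpen_ball.measurableSet)]
    refine measure_congr ?_
    have hne : ∀ᵐ f ∂μ.restrict (ball 0 1), f ≠ 0 :=
      ae_restrict_of_ae (measure_eq_zero_iff_ae_notMem.mp (measure_singleton_eq_zero hinv hO 0))
    filter_upwards [hne, ae_restrict_mem isOpen_ball.measurableSet] with f hf0 hf
    rw [mem_ball_iff_absInf, sub_zero] at hf
    refine propext ?_
    change ArtinPsi (invTranslate a f) ∈ ball a _ ↔ ArtinPsi f ∈ ball 0 _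
    rw [ArtinPsi_invTranslate ha hf hf0, mem_ball_iff_absInf, mem_ball_iff_absInf,
      add_sub_cancel_right, sub_zero]

end

/-- The restriction of the Haar measure to `X⁻¹O ∩ ᶜK` is invariant under
the Artin map `Ψ`; equivalently, `q·μ|_(X⁻¹O ∩ ᶜK)` is a `Ψ`-invariant probability measure. -/
theorem statement_15 (k : Type*) [Field k] [Fintype k] (μ : MeasureTheory.Measure (Khat k))
    (hinv : ∀ x : Khat k, MeasureTheory.Measure.map (fun y => x + y) μ = μ)
    (hO : μ (Oball k) = 1) :
    MeasureTheory.Measure.map (ArtinPsi (k := k)) (μ.restrict (XinvO k ∩ cK k))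
        = μ.restrict (XinvO k ∩ cK k) ∧
    MeasureTheory.IsProbabilityMeasure
        ((Fintype.card k : ℝ≥0∞) • μ.restrict (XinvO k ∩ cK k)) ∧
    MeasureTheory.MeasurePreserving (ArtinPsi (k := k))
        ((Fintype.card k : ℝ≥0∞) • μ.restrict (XinvO k ∩ cK k))
        ((Fintype.card k : ℝ≥0∞) • μ.restrict (XinvO k ∩ cK k)) := by
  have hmap := map_ArtinPsi_restrict_unit_ball hinv hO
  rw [restrict_inter_cK hinv hO]
  refine ⟨hmap, ⟨?_⟩, ⟨measurable_ArtinPsi, ?_⟩⟩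
  · rw [Measure.smul_apply, Measure.restrict_apply_univ, measure_unit_ball hinv hO, smul_eq_mul,
      ENNReal.mul_inv_cancel (by simp) (by simp)]
  · rw [Measure.map_smul, hmap]

end ArtinCoding
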